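/- Let m ≥ 1 be an integer and let P ∈ ℂ[x,y] be a polynomial in two variables such that P(u+v, u·v) = u^m + v^m for all u, v ∈ ℂ. Then the quotient ring ℂ[x,y]/(∂P/∂x, ∂P/∂y) by the ideal generated by the two partial derivatives of P is a finite-dimensional ℂ-vector space of dimension (m−1)(m−2)/2. -/

import Mathlib

open MvPolynomial

/-- Short exact sequence `R/(f, g) → R/(f, y * g) → R/(f, y)`: the dimensions add up. -/
theorem finrank_quotient_span_pair_mul {K R : Type*} [Field K] [CommRing R] [IsDomain R]
    [Algebra K R] {f g y : R} (hy : Prime y) (hf : ¬ y ∣ f)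
    [Module.Finite K (R ⧸ Ideal.span {f, g})] [Module.Finite K (R ⧸ Ideal.span {f, y})] :
    Module.Finite K (R ⧸ Ideal.span {f, y * g}) ∧
      Module.finrank K (R ⧸ Ideal.span {f, y * g}) =
        Module.finrank K (R ⧸ Ideal.span {f, g}) + Module.finrank K (R ⧸ Ideal.span {f, y}) := by
  have hle : Ideal.span {f, y * g} ≤ Ideal.span {f, y} := by
    rw [Ideal.span_le]
    rintro _ (rfl | rfl)
    · exact Ideal.subset_span (by simp)
    · exact Ideal.mul_mem_right _ _ (Ideal.subset_span (by simp))
  have hmul : ∀ a, a ∈ Ideal.span {f, g} ↔ y * a ∈ Ideal.span {f, y * g} := by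
    intro a
    simp only [Ideal.mem_span_pair]
    constructor
    · rintro ⟨b, c, rfl⟩
      exact ⟨y * b, c, by ring⟩
    · rintro ⟨b, c, h⟩
      obtain ⟨d, rfl⟩ : y ∣ b :=
        (hy.dvd_or_dvd (⟨a - c * g, by linear_combination h⟩ : y ∣ b * f)).resolve_right hf
      exact ⟨d, c, mul_left_cancel₀ hy.ne_zero (by linear_combination h)⟩
  let φ : (R ⧸ Ideal.span {f, g}) →ₗ[R] (R ⧸ Ideal.span {f, y * g}) :=
    Submodule.mapQ _ _ (LinearMap.mulLeft R y) fun a ha => (hmul a).1 ha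
  let ψ : (R ⧸ Ideal.span {f, y * g}) →ₗ[R] (R ⧸ Ideal.span {f, y}) :=
    Submodule.factor hle
  have hφ : Function.Injective φ := by
    rw [← LinearMap.ker_eq_bot, LinearMap.ker_eq_bot']
    intro a ha
    obtain ⟨a, rfl⟩ := Submodule.Quotient.mk_surjective _ a
    rw [Submodule.Quotient.mk_eq_zero]
    exact (hmul a).2 ((Submodule.Quotient.mk_eq_zero _).1 ha)
  have hψ : Function.Surjective ψ := Submodule.factor_surjective hle
  have hex : Function.Exact φ ψ := by
    intro a
    obtain ⟨a, rfl⟩ := Submodule.Quotient.mk_surjective _ a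
    constructor
    · intro h
      obtain ⟨b, c, hbc⟩ := Ideal.mem_span_pair.1 ((Submodule.Quotient.mk_eq_zero _).1 h)
      refine ⟨Submodule.Quotient.mk c, (Submodule.Quotient.eq _).2 ?_⟩
      exact Ideal.mem_span_pair.2 ⟨-b, 0, by
        rw [LinearMap.id_apply] at hbc
        simp only [LinearMap.mulLeft_apply]
        linear_combination -hbc⟩
    · rintro ⟨c, hc⟩
      obtain ⟨c, rfl⟩ := Submodule.Quotient.mk_surjective _ c
      rw [← hc]
      exact (Submodule.Quotient.mk_eq_zero _).2
        (Ideal.mul_mem_right _ _ (Ideal.subset_span (by simp)))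
  have hfin : Module.Finite K (R ⧸ Ideal.span {f, y * g}) :=
    Module.Finite.of_exact (f := φ.restrictScalars K) (g := ψ.restrictScalars K) hex hψ
  refine ⟨hfin, ?_⟩
  have hsum := (ψ.restrictScalars K).finrank_range_add_finrank_ker
  rw [show (ψ.restrictScalars K).range = ⊤ from LinearMap.range_eq_top.2 hψ, finrank_top,
    (LinearMap.exact_iff (f := φ.restrictScalars K) (g := ψ.restrictScalars K)).1 hex,
    LinearMap.finrank_range_of_inj (f := φ.restrictScalars K) hφ] at hsum
  omega

/-- The complete homogeneous symmetric polynomial of degree `n` in two variables, written in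
terms of the elementary symmetric functions `X 0` and `X 1`. -/
noncomputable def completeSymm (K : Type*) [CommRing K] : ℕ → MvPolynomial (Fin 2) K
  | 0 => 1
  | 1 => X 0
  | n + 2 => X 0 * completeSymm K (n + 1) - X 1 * completeSymm K n

/-- The power sum of degree `n` in two variables, written in terms of the elementary symmetric
functions `X 0` and `X 1`. -/
noncomputable def powerSum (K : Type*) [CommRing K] : ℕ → MvPolynomial (Fin 2) K
  | 0 => 2
  | 1 => X 0
  | n + 2 => X 0 * powerSum K (n + 1) - X 1 * powerSum K n

section CommRing

variable {K : Type*} [CommRing K]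

theorem eval_powerSum (u v : K) (n : ℕ) :
    eval (![u + v, u * v] : Fin 2 → K) (powerSum K n) = u ^ n + v ^ n := by
  induction n using Nat.twoStepInduction with
  | zero => simp [powerSum]; norm_num
  | one => simp [powerSum]
  | more n h₀ h₁ =>
    simp only [powerSum, map_sub, map_mul, h₀, h₁, eval_X, Matrix.cons_val_zero,
      Matrix.cons_val_one]
    ring

theorem powerSum_add_two (n : ℕ) :
    powerSum K (n + 2) = completeSymm K (n + 2) - X 1 * completeSymm K n := by
  induction n using Nat.twoStepInduction with
  | zero => simp [powerSum, completeSymm]; ring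
  | one => simp [powerSum, completeSymm]; ring
  | more n h₀ h₁ =>
    rw [powerSum, h₀, h₁]
    simp only [completeSymm]
    ring

theorem pderiv_zero_powerSum (n : ℕ) :
    pderiv 0 (powerSum K (n + 1)) = (n + 1) * completeSymm K n := by
  induction n using Nat.twoStepInduction with
  | zero => simp [powerSum, completeSymm]
  | one => simp [powerSum, completeSymm, ← map_ofNat C]; ring
  | more n h₀ h₁ =>
    rw [powerSum, map_sub, pderiv_mul, pderiv_mul, h₀, h₁, powerSum_add_two, pderiv_X_self,
      pderiv_X_of_ne (by decide)]
    simp only [completeSymm]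
    push_cast
    ring

theorem pderiv_one_powerSum (n : ℕ) :
    pderiv 1 (powerSum K (n + 2)) = -(n + 2) * completeSymm K n := by
  induction n using Nat.twoStepInduction with
  | zero => simp [powerSum, completeSymm, ← map_ofNat C]
  | one =>
    simp [powerSum, completeSymm, ← map_ofNat C]
    ring
  | more n h₀ h₁ =>
    rw [powerSum, map_sub, pderiv_mul, pderiv_mul, h₀, h₁, powerSum_add_two n, pderiv_X_self,
      pderiv_X_of_ne (by decide)]
    simp only [completeSymm]
    push_cast
    ring

theorem aeval_completeSymm (n : ℕ) :
    aeval (![Polynomial.X, 0] : Fin 2 → Polynomial K) (completeSymm K n) =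
      Polynomial.X ^ n := by
  induction n using Nat.twoStepInduction with
  | zero => simp [completeSymm]
  | one => simp [completeSymm]
  | more n h₀ h₁ => simp [completeSymm, h₁]; ring

theorem X_one_dvd_sub_aeval (p : MvPolynomial (Fin 2) K) :
    X 1 ∣ p - Polynomial.aeval (X 0)
      (aeval (![Polynomial.X, 0] : Fin 2 → Polynomial K) p) := by
  induction p using MvPolynomial.induction_on with
  | C a => simp [MvPolynomial.algebraMap_eq]
  | add p q hp hq =>
    convert dvd_add hp hq using 1
    simp only [map_add]
    ring
  | mul_X p i hp =>
    fin_cases i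
    · convert hp.mul_right (X 0) using 1
      simp
      ring
    · simp

theorem aeval_aeval_X_zero (c : Polynomial K) :
    aeval (![Polynomial.X, 0] : Fin 2 → Polynomial K)
      (Polynomial.aeval (X 0 : MvPolynomial (Fin 2) K) c) = c := by
  rw [← Polynomial.aeval_algHom_apply]
  simp

theorem ker_quotient_aeval (n : ℕ) :
    RingHom.ker ((Ideal.Quotient.mkₐ K (Ideal.span {(Polynomial.X : Polynomial K) ^ n})).comp
      (aeval (![Polynomial.X, 0] : Fin 2 → Polynomial K))) =
      Ideal.span {completeSymm K n, X 1} := by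
  ext p
  rw [RingHom.mem_ker, AlgHom.comp_apply, Ideal.Quotient.mkₐ_eq_mk,
    Ideal.Quotient.eq_zero_iff_mem, Ideal.mem_span_singleton, Ideal.mem_span_pair]
  constructor
  · rintro ⟨c, hc⟩
    obtain ⟨d, hd⟩ := X_one_dvd_sub_aeval (p - Polynomial.aeval (X 0) c * completeSymm K n)
    rw [map_sub, map_mul, aeval_aeval_X_zero, aeval_completeSymm, hc, mul_comm c, sub_self,
      map_zero, sub_zero] at hd
    exact ⟨Polynomial.aeval (X 0) c, d, by linear_combination -hd⟩
  · rintro ⟨a, b, rfl⟩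
    exact ⟨aeval ![Polynomial.X, 0] a, by simp [aeval_completeSymm, mul_comm]⟩

end CommRing

section Field

variable (K : Type*) [Field K]

theorem finrank_quotient_completeSymm_X (n : ℕ) :
    Module.Finite K (MvPolynomial (Fin 2) K ⧸ Ideal.span {completeSymm K n, X 1}) ∧
      Module.finrank K (MvPolynomial (Fin 2) K ⧸ Ideal.span {completeSymm K n, X 1}) = n := by
  have hsurj : Function.Surjective
      ((Ideal.Quotient.mkₐ K (Ideal.span {(Polynomial.X : Polynomial K) ^ n})).comp
        (aeval (![Polynomial.X, 0] : Fin 2 → Polynomial K))) :=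
    (Ideal.Quotient.mkₐ_surjective K _).comp fun c => ⟨_, aeval_aeval_X_zero c⟩
  have e := ((Ideal.quotientEquivAlgOfEq K (ker_quotient_aeval n).symm).trans
    (Ideal.quotientKerAlgEquivOfSurjective hsurj)).toLinearEquiv
  have := (Polynomial.monic_X_pow (R := K) n).finite_quotient
  exact ⟨Module.Finite.equiv e.symm, by
    rw [e.finrank_eq, finrank_quotient_span_eq_natDegree, Polynomial.natDegree_X_pow]⟩

theorem finrank_quotient_completeSymm (n : ℕ) :
    Module.Finite K (MvPolynomial (Fin 2) K ⧸
      Ideal.span {completeSymm K n, completeSymm K (n + 1)}) ∧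
      Module.finrank K (MvPolynomial (Fin 2) K ⧸
        Ideal.span {completeSymm K n, completeSymm K (n + 1)}) = (n + 1).choose 2 := by
  induction n with
  | zero =>
    have h : Ideal.span {completeSymm K 0, completeSymm K (0 + 1)} = ⊤ :=
      (Ideal.eq_top_iff_one _).2 (Ideal.subset_span (by simp [completeSymm]))
    rw [h]
    have : Subsingleton (MvPolynomial (Fin 2) K ⧸ (⊤ : Ideal (MvPolynomial (Fin 2) K))) :=
      Ideal.Quotient.subsingleton_iff.2 rfl
    exact ⟨inferInstance, by simp [Module.finrank_zero_of_subsingleton]⟩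
  | succ n ih =>
    have h : Ideal.span {completeSymm K (n + 1), completeSymm K (n + 1 + 1)} =
        Ideal.span {completeSymm K (n + 1), X 1 * completeSymm K n} := by
      ext p
      simp only [Ideal.mem_span_pair, completeSymm]
      constructor
      · rintro ⟨a, b, rfl⟩
        exact ⟨a + b * X 0, -b, by ring⟩
      · rintro ⟨a, b, rfl⟩
        exact ⟨a + b * X 0, -b, by ring⟩
    rw [Set.pair_comm] at ih
    have := ih.1
    have hX := finrank_quotient_completeSymm_X K (n + 1)
    have := hX.1
    have hndvd : ¬ (X 1 : MvPolynomial (Fin 2) K) ∣ completeSymm K (n + 1) := by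
      rintro ⟨q, hq⟩
      have := aeval_completeSymm (K := K) (n + 1)
      rw [hq] at this
      simp [eq_comm (a := (0 : Polynomial K))] at this
    have key := finrank_quotient_span_pair_mul (K := K) (g := completeSymm K n)
      (X_prime (i := 1)) hndvd
    rw [h, Nat.choose_succ_succ' (n + 1) 1, Nat.choose_one_right, add_comm (n + 1)]
    exact ⟨key.1, by rw [key.2, ih.2, hX.2]⟩

end Field

theorem exists_add_mul_eq {K : Type*} [Field K] [IsAlgClosed K] (a b : K) :
    ∃ u v : K, u + v = a ∧ u * v = b := by
  have hdeg : (Polynomial.X ^ 2 - Polynomial.C a * Polynomial.X + Polynomial.C b).degree = 2 := by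
    compute_degree!
  obtain ⟨u, hu⟩ := IsAlgClosed.exists_root _ (hdeg.trans_ne two_ne_zero)
  refine ⟨u, a - u, by ring, ?_⟩
  simp [Polynomial.IsRoot] at hu
  linear_combination -hu

theorem eq_powerSum {K : Type*} [Field K] [IsAlgClosed K] {m : ℕ} {P : MvPolynomial (Fin 2) K}
    (hP : ∀ u v : K, eval (![u + v, u * v] : Fin 2 → K) P = u ^ m + v ^ m) :
    P = powerSum K m := by
  have : Infinite K := IsAlgClosed.instInfinite
  refine MvPolynomial.funext fun x => ?_
  obtain ⟨u, v, hu, hv⟩ := exists_add_mul_eq (x 0) (x 1)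
  have hx : x = ![u + v, u * v] := by
    ext i
    fin_cases i <;> simp [hu, hv]
  rw [hx, hP, eval_powerSum]

/-- If `P ∈ ℂ[x,y]` satisfies `P(u+v, uv) = u^m + v^m` for all `u, v ∈ ℂ` (the
Kazama–Suzuki superpotential with `m = n+3`), then the Jacobian (chiral) ring
`ℂ[x,y]/(∂P/∂x, ∂P/∂y)` is a finite-dimensional `ℂ`-vector space of dimension
`(m−1)(m−2)/2`. -/
theorem stmt_19 (m : ℕ) (hm : 1 ≤ m) (P : MvPolynomial (Fin 2) ℂ)
    (hP : ∀ u v : ℂ, eval (![u + v, u * v] : Fin 2 → ℂ) P = u ^ m + v ^ m) :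
    FiniteDimensional ℂ
        (MvPolynomial (Fin 2) ℂ ⧸
          Ideal.span ({pderiv 0 P, pderiv 1 P} : Set (MvPolynomial (Fin 2) ℂ))) ∧
      Module.finrank ℂ
        (MvPolynomial (Fin 2) ℂ ⧸
          Ideal.span ({pderiv 0 P, pderiv 1 P} : Set (MvPolynomial (Fin 2) ℂ))) =
        (m - 1) * (m - 2) / 2 := by
  obtain rfl := eq_powerSum hP
  obtain rfl | ⟨n, rfl⟩ : m = 1 ∨ ∃ n, m = n + 2 := by
    rcases m with _ | _ | n
    · omega
    · exact .inl rfl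
    · exact .inr ⟨n, rfl⟩
  · have h : Ideal.span {pderiv 0 (powerSum ℂ 1), pderiv 1 (powerSum ℂ 1)} = ⊤ :=
      (Ideal.eq_top_iff_one _).2 (Ideal.subset_span (by simp [powerSum]))
    rw [h]
    have : Subsingleton (MvPolynomial (Fin 2) ℂ ⧸ (⊤ : Ideal (MvPolynomial (Fin 2) ℂ))) :=
      Ideal.Quotient.subsingleton_iff.2 rfl
    exact ⟨inferInstance, by simp [Module.finrank_zero_of_subsingleton]⟩
  · have hunit : IsUnit ((n : MvPolynomial (Fin 2) ℂ) + 2) := by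
      have h : IsUnit ((n : ℂ) + 2) := isUnit_iff_ne_zero.2 (by norm_cast)
      simpa only [map_add, map_natCast, map_ofNat] using h.map (C (σ := Fin 2))
    have h : Ideal.span {pderiv 0 (powerSum ℂ (n + 2)), pderiv 1 (powerSum ℂ (n + 2))} =
        Ideal.span {completeSymm ℂ n, completeSymm ℂ (n + 1)} := by
      rw [pderiv_zero_powerSum, pderiv_one_powerSum, Ideal.span_insert, Ideal.span_insert,
        Ideal.span_singleton_mul_left_unit hunit.neg,
        Ideal.span_singleton_mul_left_unit (by convert hunit using 1; push_cast; ring), sup_comm]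
    rw [h]
    have key := finrank_quotient_completeSymm ℂ n
    refine ⟨key.1, key.2.trans ?_⟩
    rw [Nat.choose_two_right]
    simp
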